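/- arXiv:1204.4435 — 3 statements merged into one kernel-verified Lean document; each statement's English description precedes it below -/
import Mathlib

section
/- Let X be a finite connected simple graph with at least 2 vertices and let f₁, f₂ : V(X) → ℝ be nonzero functions such that no vertex in the support of f₁ equals or is adjacent to a vertex in the support of f₂. Then λ1(X) ≤ max(R_X(f₁), R_X(f₂)). -/
noncomputable section

open scoped Classical in
/-- The Rayleigh quotient `R_X(f) = (½ ∑_{x∼y} (f x − f y)²) / (∑_x f x²)`,
where the numerator sum runs over ordered pairs of adjacent vertices. -/
def rayleighQuot {V : Type} [Fintype V] (G : SimpleGraph V) (f : V → ℝ) : ℝ :=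
  (2⁻¹ * ∑ x : V, ∑ y : V, if G.Adj x y then (f x - f y) ^ 2 else 0) / ∑ x : V, (f x) ^ 2

/-- The spectral gap `λ₁(X)`, i.e. the smallest Rayleigh quotient of a nonzero
function of mean zero; for finite connected graphs this is the second-smallest
eigenvalue of the combinatorial Laplacian. -/
def spectralGap {V : Type} [Fintype V] (G : SimpleGraph V) : ℝ :=
  sInf {r : ℝ | ∃ f : V → ℝ, f ≠ 0 ∧ (∑ x : V, f x) = 0 ∧ rayleighQuot G f = r}

open scoped Classical in
/-- The Dirichlet energy, the numerator of the Rayleigh quotient. -/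
def dirichletEnergy {V : Type} [Fintype V] (G : SimpleGraph V) (f : V → ℝ) : ℝ :=
  2⁻¹ * ∑ x : V, ∑ y : V, if G.Adj x y then (f x - f y) ^ 2 else 0

lemma rayleighQuot_eq_dirichletEnergy_div {V : Type} [Fintype V] (G : SimpleGraph V)
    (f : V → ℝ) : rayleighQuot G f = dirichletEnergy G f / ∑ x, f x ^ 2 :=
  rfl

lemma dirichletEnergy_nonneg {V : Type} [Fintype V] (G : SimpleGraph V) (f : V → ℝ) :
    0 ≤ dirichletEnergy G f := by
  refine mul_nonneg (by norm_num) (Finset.sum_nonneg fun x _ ↦ Finset.sum_nonneg fun y _ ↦ ?_)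
  split_ifs <;> positivity

lemma rayleighQuot_nonneg {V : Type} [Fintype V] (G : SimpleGraph V) (f : V → ℝ) :
    0 ≤ rayleighQuot G f :=
  div_nonneg (dirichletEnergy_nonneg G f) (Finset.sum_nonneg fun _ _ ↦ sq_nonneg _)

lemma spectralGap_le_rayleighQuot {V : Type} [Fintype V] (G : SimpleGraph V) {f : V → ℝ}
    (hf : f ≠ 0) (hsum : ∑ x, f x = 0) : spectralGap G ≤ rayleighQuot G f :=
  csInf_le ⟨0, by rintro _ ⟨g, -, -, rfl⟩; exact rayleighQuot_nonneg G g⟩ ⟨f, hf, hsum, rfl⟩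

lemma sum_sq_pos {V : Type} [Fintype V] {f : V → ℝ} (hf : f ≠ 0) : 0 < ∑ x, f x ^ 2 := by
  obtain ⟨x, hx⟩ := Function.ne_iff.mp hf
  exact Finset.sum_pos' (fun _ _ ↦ sq_nonneg _) ⟨x, Finset.mem_univ x, sq_pos_iff.mpr hx⟩

lemma sum_sq_linearCombination {V : Type} [Fintype V] {f g : V → ℝ}
    (h : ∀ x, f x * g x = 0) (a b : ℝ) :
    ∑ x, (a * f x + b * g x) ^ 2 = a ^ 2 * ∑ x, f x ^ 2 + b ^ 2 * ∑ x, g x ^ 2 := by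
  simp_rw [Finset.mul_sum, ← Finset.sum_add_distrib]
  refine Finset.sum_congr rfl fun x _ ↦ ?_
  linear_combination 2 * a * b * h x

/-- The energy is additive on linear combinations of functions with disjoint, non-adjacent
supports. -/
lemma dirichletEnergy_linearCombination {V : Type} [Fintype V] (G : SimpleGraph V)
    {f g : V → ℝ} (h : ∀ x, f x * g x = 0) (hadj : ∀ x y, G.Adj x y → f x * g y = 0)
    (a b : ℝ) :
    dirichletEnergy G (fun x ↦ a * f x + b * g x) =
      a ^ 2 * dirichletEnergy G f + b ^ 2 * dirichletEnergy G g := by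
  simp_rw [dirichletEnergy, Finset.mul_sum, ← Finset.sum_add_distrib]
  refine Finset.sum_congr rfl fun x _ ↦ Finset.sum_congr rfl fun y _ ↦ ?_
  split_ifs with hxy
  · linear_combination a * b * (h x + h y - hadj x y hxy - hadj y x hxy.symm)
  · simp

lemma rayleighQuot_linearCombination_le {V : Type} [Fintype V] (G : SimpleGraph V)
    {f g : V → ℝ} (hf : f ≠ 0) (hg : g ≠ 0) (h : ∀ x, f x * g x = 0)
    (hadj : ∀ x y, G.Adj x y → f x * g y = 0) {a b : ℝ}
    (hne : (fun x ↦ a * f x + b * g x) ≠ 0) :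
    rayleighQuot G (fun x ↦ a * f x + b * g x) ≤ max (rayleighQuot G f) (rayleighQuot G g) := by
  have hF := (div_le_iff₀ (sum_sq_pos hf)).mp (le_max_left (rayleighQuot G f) (rayleighQuot G g))
  have hG := (div_le_iff₀ (sum_sq_pos hg)).mp (le_max_right (rayleighQuot G f) (rayleighQuot G g))
  rw [rayleighQuot_eq_dirichletEnergy_div G (fun x ↦ a * f x + b * g x),
    div_le_iff₀ (sum_sq_pos hne), dirichletEnergy_linearCombination G h hadj,
    sum_sq_linearCombination h]
  calc a ^ 2 * dirichletEnergy G f + b ^ 2 * dirichletEnergy G g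
      ≤ a ^ 2 * (max (rayleighQuot G f) (rayleighQuot G g) * ∑ x, f x ^ 2) +
          b ^ 2 * (max (rayleighQuot G f) (rayleighQuot G g) * ∑ x, g x ^ 2) :=
        add_le_add (mul_le_mul_of_nonneg_left hF (sq_nonneg a))
          (mul_le_mul_of_nonneg_left hG (sq_nonneg b))
    _ = _ := by ring

/-- If `f₁, f₂` are nonzero functions on the vertices of a finite connected simple graph
`X` with at least two vertices, and no vertex in the support of `f₁` equals or is adjacent
to a vertex in the support of `f₂`, then `λ₁(X) ≤ max(R_X(f₁), R_X(f₂))`. -/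
theorem spectralGap_le_max_rayleigh_of_disjoint_supports
    {α : Type} [Fintype α] (G : SimpleGraph α) (hconn : G.Connected)
    (hcard : 2 ≤ Fintype.card α) (f₁ f₂ : α → ℝ) (hf₁ : f₁ ≠ 0) (hf₂ : f₂ ≠ 0)
    (hdisj : ∀ x y : α, f₁ x ≠ 0 → f₂ y ≠ 0 → x ≠ y ∧ ¬ G.Adj x y) :
    spectralGap G ≤ max (rayleighQuot G f₁) (rayleighQuot G f₂) := by
  by_cases hsum : ∑ x, f₁ x = 0
  · exact (spectralGap_le_rayleighQuot G hf₁ hsum).trans (le_max_left _ _)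
  have h : ∀ x, f₁ x * f₂ x = 0 := fun x ↦ by
    by_contra hx
    exact (hdisj x x (left_ne_zero_of_mul hx) (right_ne_zero_of_mul hx)).1 rfl
  have hadj : ∀ x y, G.Adj x y → f₁ x * f₂ y = 0 := fun x y hxy ↦ by
    by_contra hx
    exact (hdisj x y (left_ne_zero_of_mul hx) (right_ne_zero_of_mul hx)).2 hxy
  have hne : (fun x ↦ (∑ z, f₂ z) * f₁ x + (-∑ z, f₁ z) * f₂ x) ≠ 0 := by
    obtain ⟨y, hy⟩ := Function.ne_iff.mp hf₂
    have hy₁ : f₁ y = 0 := (mul_eq_zero.mp (h y)).resolve_right hy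
    refine Function.ne_iff.mpr ⟨y, ?_⟩
    simpa [hy₁, hsum] using hy
  refine (spectralGap_le_rayleighQuot G hne ?_).trans
    (rayleighQuot_linearCombination_le G hf₁ hf₂ h hadj hne)
  rw [Finset.sum_add_distrib, ← Finset.mul_sum, ← Finset.mul_sum]
  ring
end
end

section
/- Let R > 0 and M > 0, let φ : ℝ → ℝ be continuous with 0 < φ(t) ≤ M for all t ∈ [0,R], and let F : ℝ × ℝ → ℝ be continuously differentiable with F(t, θ + 1) = F(t, θ) for all (t, θ), and suppose that ∫₀¹ F(t, θ) dθ = 0 for every t ∈ [0,R]. Then ∫₀ᴿ (∫₀¹ ( (∂F/∂t)(t,θ)² + φ(t)⁻²·(∂F/∂θ)(t,θ)² ) dθ) · φ(t) dt ≥ (4π²/M²) · ∫₀ᴿ (∫₀¹ F(t,θ)² dθ) · φ(t) dt. -/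
open Real

/-- **Wirtinger's inequality** on the circle of length `1`: a `C¹` function with equal values at
the endpoints of `[0, 1]` and mean zero satisfies `4π² ∫ g² ≤ ∫ (deriv g)²`. -/
theorem wirtinger_unit_interval {g g' : ℝ → ℝ} (hg : ∀ x, HasDerivAt g (g' x) x)
    (hg' : Continuous g') (hper : g 1 = g 0) (hmean : ∫ x in (0:ℝ)..1, g x = 0) :
    4 * π ^ 2 * ∫ x in (0:ℝ)..1, g x ^ 2 ≤ ∫ x in (0:ℝ)..1, g' x ^ 2 := by
  have hgc : Continuous g := continuous_iff_continuousAt.2 fun x => (hg x).continuousAt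
  have parseval : ∀ f : ℝ → ℝ, Continuous f →
      HasSum (fun n => ‖fourierCoeffOn zero_lt_one (fun x => (f x : ℂ)) n‖ ^ 2)
        (∫ x in (0:ℝ)..1, f x ^ 2) := by
    intro f hf
    have hfc : Continuous fun x => (f x : ℂ) := Complex.continuous_ofReal.comp hf
    have hL2 : MeasureTheory.MemLp (fun x => (f x : ℂ)) 2
        (MeasureTheory.volume.restrict (Set.Ioc (0:ℝ) 1)) := by
      obtain ⟨C, hC⟩ := (isCompact_Icc (a := (0:ℝ)) (b := 1)).exists_bound_of_continuousOn
        hfc.continuousOn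
      refine MeasureTheory.MemLp.of_bound hfc.aestronglyMeasurable C ?_
      filter_upwards [MeasureTheory.ae_restrict_mem measurableSet_Ioc] with x hx
      exact hC x (Set.Ioc_subset_Icc_self hx)
    simpa using hasSum_sq_fourierCoeffOn zero_lt_one hL2
  refine hasSum_le (fun n => ?_) ((parseval g hgc).mul_left (4 * π ^ 2)) (parseval g' hg')
  rcases eq_or_ne n 0 with rfl | hn
  · have h0 : fourierCoeffOn zero_lt_one (fun x => (g x : ℂ)) 0 = 0 := by
      rw [fourierCoeffOn_eq_integral]
      simp [intervalIntegral.integral_ofReal, hmean]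
    rw [h0, norm_zero, zero_pow two_ne_zero, mul_zero]
    positivity
  · have hcoeff := fourierCoeffOn_of_hasDerivAt zero_lt_one hn
      (fun x _ => (hg x).ofReal_comp)
      ((Complex.continuous_ofReal.comp hg').intervalIntegrable 0 1)
    have hn1 : (1:ℝ) ≤ (n:ℝ) ^ 2 := by
      exact_mod_cast (one_le_sq_iff_one_le_abs n).2 (Int.one_le_abs hn)
    rw [hcoeff]
    simp only [hper, sub_self, mul_zero, zero_sub, Complex.ofReal_one, Complex.ofReal_zero,
      sub_zero, one_mul, mul_neg, norm_neg, norm_mul, norm_div, norm_one, Complex.norm_real,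
      Complex.norm_I, Complex.norm_intCast, RCLike.norm_ofNat, mul_one, mul_pow, div_pow, one_pow, Real.norm_eq_abs, sq_abs]
    rw [div_mul_eq_mul_div, one_mul, mul_div_assoc', div_le_iff₀ (by positivity)]
    nlinarith [mul_le_mul_of_nonneg_left hn1 (show 0 ≤ 4 * π ^ 2 *
      ‖fourierCoeffOn zero_lt_one (fun x => (g' x : ℂ)) n‖ ^ 2 by positivity)]

/-- Fiberwise Poincaré–Wirtinger inequality on the warped cylinder
`([0,R] × S¹, dt² + φ(t)² dθ²)` with `S¹` the circle of length 1: if `F` is `C¹`,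
`1`-periodic in `θ`, and has mean zero on every fiber `{t} × S¹` with `t ∈ [0,R]`, and
`0 < φ ≤ M` on `[0,R]`, then the Dirichlet energy of `F` is at least `4π²/M²` times its
squared `L²`-norm, both computed with respect to the Riemannian volume `φ(t) dθ dt`. -/
theorem dirichlet_energy_ge_of_fiberwise_mean_zero
    (R M : ℝ) (hR : 0 < R) (hM : 0 < M) (φ : ℝ → ℝ) (hφcont : Continuous φ)
    (hφpos : ∀ t ∈ Set.Icc 0 R, 0 < φ t) (hφle : ∀ t ∈ Set.Icc 0 R, φ t ≤ M)
    (F : ℝ × ℝ → ℝ) (hF : ContDiff ℝ 1 F)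
    (hper : ∀ t θ : ℝ, F (t, θ + 1) = F (t, θ))
    (hmean : ∀ t ∈ Set.Icc 0 R, (∫ θ in (0:ℝ)..1, F (t, θ)) = 0) :
    ∫ t in (0:ℝ)..R,
        (∫ θ in (0:ℝ)..1,
          (deriv (fun s => F (s, θ)) t) ^ 2 +
            ((φ t) ^ 2)⁻¹ * (deriv (fun s => F (t, s)) θ) ^ 2) * φ t
      ≥ (4 * π ^ 2 / M ^ 2) *
        ∫ t in (0:ℝ)..R, (∫ θ in (0:ℝ)..1, (F (t, θ)) ^ 2) * φ t := by
  have hFc : Continuous F := hF.continuous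
  have hd : Differentiable ℝ F := hF.differentiable one_ne_zero
  have hfd : Continuous (fderiv ℝ F) := hF.continuous_fderiv one_ne_zero
  have ht : ∀ t θ, HasDerivAt (fun s => F (s, θ)) (fderiv ℝ F (t, θ) (1, 0)) t := fun t θ =>
    (hd (t, θ)).hasFDerivAt.comp_hasDerivAt t ((hasDerivAt_id t).prodMk (hasDerivAt_const t θ))
  have hθ : ∀ t θ, HasDerivAt (fun s => F (t, s)) (fderiv ℝ F (t, θ) (0, 1)) θ := fun t θ =>
    (hd (t, θ)).hasFDerivAt.comp_hasDerivAt θ ((hasDerivAt_const θ t).prodMk (hasDerivAt_id θ))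
  simp only [(ht _ _).deriv, (hθ _ _).deriv]
  have hct : Continuous fun p : ℝ × ℝ => (fderiv ℝ F p (1, 0)) ^ 2 := by fun_prop
  have hcθ' : Continuous fun p : ℝ × ℝ => fderiv ℝ F p (0, 1) := by fun_prop
  have hcθ : Continuous fun p : ℝ × ℝ => (fderiv ℝ F p (0, 1)) ^ 2 := by fun_prop
  have hcF : Continuous fun p : ℝ × ℝ => F p ^ 2 := by fun_prop
  have fiber_integral_continuous : ∀ G : ℝ × ℝ → ℝ, Continuous G →
      Continuous fun t => ∫ θ in (0:ℝ)..1, G (t, θ) := fun G hG =>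
    intervalIntegral.continuous_parametric_intervalIntegral_of_continuous'
      (f := fun t θ => G (t, θ)) hG 0 1
  have fiber_split : ∀ t, (∫ θ in (0:ℝ)..1, ((fderiv ℝ F (t, θ) (1, 0)) ^ 2 +
      ((φ t) ^ 2)⁻¹ * (fderiv ℝ F (t, θ) (0, 1)) ^ 2)) =
      (∫ θ in (0:ℝ)..1, (fderiv ℝ F (t, θ) (1, 0)) ^ 2) +
        ((φ t) ^ 2)⁻¹ * ∫ θ in (0:ℝ)..1, (fderiv ℝ F (t, θ) (0, 1)) ^ 2 := by
    intro t
    have hpair : Continuous fun θ : ℝ => (t, θ) := by fun_prop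
    rw [← intervalIntegral.integral_const_mul]
    exact intervalIntegral.integral_add ((hct.comp hpair).intervalIntegrable 0 1)
      (((hcθ.comp hpair).intervalIntegrable 0 1).const_mul _)
  simp only [fiber_split]
  rw [ge_iff_le, ← intervalIntegral.integral_const_mul]
  refine intervalIntegral.integral_mono_on hR.le ?_ ?_ fun t htR => ?_
  · exact (((fiber_integral_continuous _ hcF).mul hφcont).const_mul _).intervalIntegrable 0 R
  · apply ContinuousOn.intervalIntegrable
    rw [Set.uIcc_of_le hR.le]
    exact ((fiber_integral_continuous _ hct).continuousOn.add
      (((hφcont.pow 2).continuousOn.inv₀ fun t h => (pow_pos (hφpos t h) 2).ne').mul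
        (fiber_integral_continuous _ hcθ).continuousOn)).mul hφcont.continuousOn
  · rw [← mul_assoc]
    have hφt := hφpos t htR
    refine mul_le_mul_of_nonneg_right ?_ hφt.le
    have hW := wirtinger_unit_interval (hθ t) (hcθ'.comp (by fun_prop : Continuous fun θ => (t, θ)))
      (by simpa using hper t 0) (hmean t htR)
    have hA : 0 ≤ ∫ θ in (0:ℝ)..1, (fderiv ℝ F (t, θ) (1, 0)) ^ 2 :=
      intervalIntegral.integral_nonneg zero_le_one fun _ _ => sq_nonneg _
    have hN : 0 ≤ ∫ θ in (0:ℝ)..1, F (t, θ) ^ 2 :=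
      intervalIntegral.integral_nonneg zero_le_one fun _ _ => sq_nonneg _
    calc 4 * π ^ 2 / M ^ 2 * ∫ θ in (0:ℝ)..1, F (t, θ) ^ 2
        = (M ^ 2)⁻¹ * (4 * π ^ 2 * ∫ θ in (0:ℝ)..1, F (t, θ) ^ 2) := by ring
      _ ≤ (φ t ^ 2)⁻¹ * (4 * π ^ 2 * ∫ θ in (0:ℝ)..1, F (t, θ) ^ 2) := by
          gcongr
          exact hφle t htR
      _ ≤ (φ t ^ 2)⁻¹ * ∫ θ in (0:ℝ)..1, (fderiv ℝ F (t, θ) (0, 1)) ^ 2 := by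
          gcongr
      _ ≤ _ := le_add_of_nonneg_left hA
end

section
/- There is an absolute constant C > 0 such that the following holds. Let R ≥ 4 and let ρ : ℝ → ℝ be a function with ρ(t) ≥ 1 for all t ∈ [0,R], ρ(t) = 0 for all t ∉ [0,R], and |ρ(t) − ρ(s)| ≤ 3 whenever t, s ∈ ℝ satisfy |t − s| < 1/2. Then there exists an infinitely differentiable function σ : ℝ → ℝ such that: (i) σ(t) > 0 for all t ∈ ℝ; (ii) C⁻¹·ρ(t) ≤ σ(t) ≤ C·ρ(t) for all t ∈ [0,R]; (iii) |σ''(t)| ≤ C for all t ∈ ℝ; and (iv) σ(t) = 1 for all t ∈ [0,1] ∪ [R−1,R]. -/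
open Real Set

namespace Real.smoothTransition

lemma continuous_deriv_deriv : Continuous (deriv (deriv smoothTransition)) := by
  have h : ContDiff ℝ 2 smoothTransition := smoothTransition.contDiff
  have := h.continuous_iteratedDeriv 2 le_rfl
  rwa [iteratedDeriv_succ, iteratedDeriv_one] at this

lemma deriv_deriv_eq_zero_of_notMem_Ioo {t : ℝ} (ht : t ∉ Ioo (0 : ℝ) 1) :
    deriv (deriv smoothTransition) t = 0 := by
  have hloc {c : ℝ} {U : Set ℝ} (hU : IsOpen U) (h : EqOn smoothTransition (fun _ => c) U) :
      EqOn (deriv (deriv smoothTransition)) (fun _ => 0) U := fun x hx => by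
    have h1 := (h.eventuallyEq_of_mem (hU.mem_nhds hx)).deriv.deriv_eq
    simpa using h1
  rcases not_and_or.1 ht with h | h
  · have := (hloc isOpen_Iio (fun x hx => zero_of_nonpos (le_of_lt hx))).closure
      continuous_deriv_deriv continuous_const
    rw [closure_Iio] at this
    exact this (not_lt.1 h)
  · have := (hloc isOpen_Ioi (fun x hx => one_of_one_le (le_of_lt hx))).closure
      continuous_deriv_deriv continuous_const
    rw [closure_Ioi] at this
    exact this (not_lt.1 h)

lemma exists_abs_deriv_deriv_le :
    ∃ M : ℝ, 0 ≤ M ∧ ∀ t, |deriv (deriv smoothTransition) t| ≤ M := by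
  obtain ⟨M, hM⟩ := (isCompact_Icc (a := (0 : ℝ)) (b := 1)).exists_bound_of_continuousOn
    continuous_deriv_deriv.continuousOn
  refine ⟨M, (norm_nonneg _).trans (hM 0 (by simp)), fun t => ?_⟩
  by_cases ht : t ∈ Ioo (0 : ℝ) 1
  · exact hM t (Ioo_subset_Icc_self ht)
  · rw [deriv_deriv_eq_zero_of_notMem_Ioo ht, abs_zero]
    exact (norm_nonneg _).trans (hM 0 (by simp))

end Real.smoothTransition

/-- The smooth interpolation of the values `a 0, …, a n` at the integers `0, …, n`, monotone on
each `[k, k + 1]` and constant on `(-∞, 0]` and on `[n, ∞)`. -/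
noncomputable def smoothInterpolation (a : ℕ → ℝ) (n : ℕ) (t : ℝ) : ℝ :=
  a 0 + ∑ k ∈ Finset.range n, (a (k + 1) - a k) * smoothTransition (t - k)

namespace smoothInterpolation

variable {a : ℕ → ℝ} {n : ℕ} {t : ℝ}

lemma contDiff : ContDiff ℝ (⊤ : ℕ∞) (smoothInterpolation a n) :=
  contDiff_const.add <| ContDiff.sum fun _ _ => contDiff_const.mul <|
    smoothTransition.contDiff.comp (contDiff_id.sub contDiff_const)

lemma eq_of_nonpos (ht : t ≤ 0) : smoothInterpolation a n t = a 0 := by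
  unfold smoothInterpolation
  rw [Finset.sum_eq_zero, add_zero]
  intro k _
  have : (0 : ℝ) ≤ k := k.cast_nonneg
  rw [smoothTransition.zero_of_nonpos (by linarith), mul_zero]

lemma eq_of_le (ht : n ≤ t) : smoothInterpolation a n t = a n := by
  unfold smoothInterpolation
  rw [Finset.sum_congr rfl fun k hk => ?_, Finset.sum_range_sub a, add_sub_cancel]
  have : (k : ℝ) + 1 ≤ n := by exact_mod_cast Finset.mem_range.1 hk
  rw [smoothTransition.one_of_one_le (by linarith), mul_one]

lemma eq_of_mem_Icc {m : ℕ} (hm : m < n) (ht : t ∈ Icc (m : ℝ) (m + 1)) :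
    smoothInterpolation a n t = a m + (a (m + 1) - a m) * smoothTransition (t - m) := by
  obtain ⟨d, rfl⟩ := Nat.exists_eq_add_of_lt hm
  have hhead := eq_of_le (a := a) ht.1
  unfold smoothInterpolation at hhead ⊢
  rw [add_assoc m d 1, Finset.sum_range_add, Finset.sum_range_succ', ← add_assoc,
    ← add_assoc, add_right_comm, hhead, add_zero, Finset.sum_eq_zero, add_zero]
  intro k _
  rw [smoothTransition.zero_of_nonpos, mul_zero]
  have : (0 : ℝ) ≤ k := k.cast_nonneg
  have := ht.2
  push_cast
  linarith

lemma deriv_deriv : deriv (deriv (smoothInterpolation a n)) t =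
    ∑ k ∈ Finset.range n, (a (k + 1) - a k) * deriv (deriv smoothTransition) (t - k) := by
  have hS : ContDiff ℝ 2 smoothTransition := smoothTransition.contDiff
  have h0 : Differentiable ℝ smoothTransition := hS.differentiable (by norm_num)
  have h1 : Differentiable ℝ (deriv smoothTransition) :=
    (hS.iterate_deriv' 1 1).differentiable (by norm_num)
  have key (f : ℝ → ℝ) (hf : Differentiable ℝ f) (c : ℝ) (x : ℝ) :
      HasDerivAt (fun x => c + ∑ k ∈ Finset.range n, (a (k + 1) - a k) * f (x - k))
        (∑ k ∈ Finset.range n, (a (k + 1) - a k) * deriv f (x - k)) x :=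
    (HasDerivAt.fun_sum (A := fun k x => (a (k + 1) - a k) * f (x - k)) fun k _ =>
      ((hf (x - k)).hasDerivAt.comp_sub_const x k).const_mul (a (k + 1) - a k)).const_add c
  have hd : deriv (smoothInterpolation a n) = fun x =>
      0 + ∑ k ∈ Finset.range n, (a (k + 1) - a k) * deriv smoothTransition (x - k) := by
    funext x
    rw [zero_add]
    exact (key _ h0 (a 0) x).deriv
  rw [hd]
  exact (key _ h1 0 t).deriv

lemma abs_deriv_deriv_le {D M : ℝ} (hD : 0 ≤ D) (ha : ∀ k < n, |a (k + 1) - a k| ≤ D)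
    (hM : ∀ x, |deriv (deriv smoothTransition) x| ≤ M) :
    |deriv (deriv (smoothInterpolation a n)) t| ≤ D * M := by
  have hM0 : 0 ≤ M := (abs_nonneg _).trans (hM 0)
  rw [deriv_deriv]
  calc _ ≤ ∑ k ∈ Finset.range n, |(a (k + 1) - a k) * deriv (deriv smoothTransition) (t - k)| :=
        Finset.abs_sum_le_sum_abs _ _
    _ ≤ ∑ k ∈ Finset.range n, if k = ⌊t⌋₊ then D * M else 0 := by
        refine Finset.sum_le_sum fun k hk => ?_
        split_ifs with h
        · rw [abs_mul]
          exact mul_le_mul (ha k (Finset.mem_range.1 hk)) (hM _) (abs_nonneg _) hD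
        · rw [smoothTransition.deriv_deriv_eq_zero_of_notMem_Ioo, mul_zero, abs_zero]
          rintro ⟨h0, h1⟩
          have : (0 : ℝ) ≤ k := k.cast_nonneg
          exact h ((Nat.floor_eq_iff (by linarith)).2 ⟨by linarith, by linarith⟩).symm
    _ ≤ D * M := by
        rw [Finset.sum_ite_eq']
        split_ifs
        · exact le_rfl
        · positivity

end smoothInterpolation

lemma abs_sub_le_nine_of_abs_sub_le_one {ρ : ℝ → ℝ}
    (hρ : ∀ t s : ℝ, |t - s| < 1 / 2 → |ρ t - ρ s| ≤ 3) {t s : ℝ} (h : |t - s| ≤ 1) :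
    |ρ t - ρ s| ≤ 9 := by
  have := abs_le.1 h
  have h1 := abs_le.1 (hρ t (t + (s - t) / 3) (by rw [abs_lt]; constructor <;> linarith))
  have h2 := abs_le.1 (hρ (t + (s - t) / 3) (t + 2 * (s - t) / 3)
    (by rw [abs_lt]; constructor <;> linarith))
  have h3 := abs_le.1 (hρ (t + 2 * (s - t) / 3) s (by rw [abs_lt]; constructor <;> linarith))
  rw [abs_le]
  constructor <;> linarith

/-- There is an absolute constant `C > 0` such that: for every `R ≥ 4` and every density
`ρ : ℝ → ℝ` with `ρ ≥ 1` on `[0,R]`, `ρ = 0` outside `[0,R]`, and `|ρ(t) − ρ(s)| ≤ 3`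
whenever `|t − s| < 1/2`, there is a smooth function `σ : ℝ → ℝ` which is positive,
comparable to `ρ` on `[0,R]` (within a factor `C`), has second derivative bounded by `C`,
and equals `1` on `[0,1] ∪ [R−1,R]`. -/
theorem exists_smooth_density :
    ∃ C : ℝ, 0 < C ∧
      ∀ (R : ℝ) (ρ : ℝ → ℝ), 4 ≤ R →
        (∀ t ∈ Icc 0 R, 1 ≤ ρ t) →
        (∀ t ∉ Icc 0 R, ρ t = 0) →
        (∀ t s : ℝ, |t - s| < 1 / 2 → |ρ t - ρ s| ≤ 3) →
        ∃ σ : ℝ → ℝ, ContDiff ℝ (⊤ : ℕ∞) σ ∧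
          (∀ t : ℝ, 0 < σ t) ∧
          (∀ t ∈ Icc 0 R, C⁻¹ * ρ t ≤ σ t ∧ σ t ≤ C * ρ t) ∧
          (∀ t : ℝ, |deriv (deriv σ) t| ≤ C) ∧
          (∀ t ∈ Icc (0:ℝ) 1 ∪ Icc (R - 1) R, σ t = 1) := by
  obtain ⟨M, hM0, hM⟩ := smoothTransition.exists_abs_deriv_deriv_le
  refine ⟨270 + 61 * M, by positivity, fun R ρ hR hone hzero hosc => ?_⟩
  have hnine {t s : ℝ} (h0 : -1 ≤ t - s) (h1 : t - s ≤ 1) : -9 ≤ ρ t - ρ s ∧ ρ t - ρ s ≤ 9 :=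
    abs_le.1 (abs_sub_le_nine_of_abs_sub_le_one hosc (abs_le.2 ⟨h0, h1⟩))
  have hleft {t : ℝ} (h0 : 0 ≤ t) (h1 : t ≤ 1) : ρ t ≤ 27 := by
    have := hnine (t := t) (s := t - 1) (by linarith) (by linarith)
    have := hnine (t := t - 1) (s := t - 2) (by linarith) (by linarith)
    have := hzero (t - 2) (fun h => by linarith [h.1])
    linarith
  have hright {t : ℝ} (h0 : R - 2 < t) : ρ t ≤ 27 := by
    have := hnine (t := t) (s := t + 1) (by linarith) (by linarith)
    have := hnine (t := t + 1) (s := t + 2) (by linarith) (by linarith)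
    have := hzero (t + 2) (fun h => by linarith [h.2])
    linarith
  set n : ℕ := ⌊R - 1⌋₊
  have hnR : (n : ℝ) ≤ R - 1 := Nat.floor_le (by linarith)
  have hRn : R - 1 < n + 1 := Nat.lt_floor_add_one _
  have hn3 : 3 ≤ n := Nat.le_floor (by push_cast; linarith)
  set a : ℕ → ℝ := fun k => if 2 ≤ k ∧ k < n then ρ k else 1
  have ha1 {k : ℕ} (hk : ¬ (2 ≤ k ∧ k < n)) : a k = 1 := if_neg hk
  have hρa {k : ℕ} (hk : k ≤ n) : 1 ≤ a k ∧ a k ≤ ρ k ∧ ρ k ≤ 27 * a k ∧ ρ k ≤ a k + 26 := by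
    have hk' : (k : ℝ) ≤ n := by exact_mod_cast hk
    have hk0 : (0 : ℝ) ≤ k := k.cast_nonneg
    have h1 : 1 ≤ ρ k := hone k ⟨hk0, by linarith⟩
    by_cases h : 2 ≤ k ∧ k < n
    · have : a k = ρ k := if_pos h
      rw [this]
      refine ⟨h1, le_rfl, ?_, ?_⟩ <;> linarith
    · have h27 : ρ k ≤ 27 := by
        rcases not_and_or.1 h with h | h
        · exact hleft hk0 (by exact_mod_cast (by omega : k ≤ 1))
        · have : k = n := by omega
          subst this
          exact hright (by linarith)
      rw [ha1 h]
      refine ⟨le_rfl, h1, ?_, ?_⟩ <;> linarith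
  have hdiff (k : ℕ) (hk : k < n) : |a (k + 1) - a k| ≤ 61 := by
    obtain ⟨_, h1, _, h2⟩ := hρa hk.le
    obtain ⟨_, h3, _, h4⟩ := hρa (k := k + 1) hk
    have := hnine (t := (k + 1 : ℕ)) (s := k) (by push_cast; linarith) (by push_cast; linarith)
    rw [abs_le]
    constructor <;> linarith
  -- On each cell, `σ` is a convex combination of the two neighbouring values of `a`.
  have hcell {t : ℝ} (h0 : 0 ≤ t) (h1 : t < n) : ρ t ≤ 270 * smoothInterpolation a n t ∧
      smoothInterpolation a n t ≤ 10 * ρ t ∧ 0 < smoothInterpolation a n t := by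
    have hm : ⌊t⌋₊ < n := (Nat.floor_lt h0).2 h1
    have hmt := Nat.floor_le h0
    have htm := Nat.lt_floor_add_one t
    rw [smoothInterpolation.eq_of_mem_Icc hm ⟨hmt, htm.le⟩]
    generalize ⌊t⌋₊ = m at hm hmt htm ⊢
    have hs0 := smoothTransition.nonneg (t - m)
    have hs1 := sub_nonneg.2 (smoothTransition.le_one (t - m))
    generalize smoothTransition (t - m) = s at hs0 hs1 ⊢
    obtain ⟨h1, h2, h3, -⟩ := hρa hm.le
    obtain ⟨h4, h5, h6, -⟩ := hρa (k := m + 1) hm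
    have hm' := hnine (t := t) (s := m) (by linarith) (by linarith)
    have hm'' := hnine (t := t) (s := (m + 1 : ℕ)) (by push_cast; linarith)
      (by push_cast; linarith)
    have ht1 := hone t ⟨h0, by linarith⟩
    have hcomb {x : ℝ} (hx : x ≤ a m) (hx' : x ≤ a (m + 1)) :
        x ≤ a m + (a (m + 1) - a m) * s := by
      nlinarith [mul_nonneg hs1 (sub_nonneg.2 hx), mul_nonneg hs0 (sub_nonneg.2 hx')]
    have hcomb' {x : ℝ} (hx : a m ≤ x) (hx' : a (m + 1) ≤ x) :
        a m + (a (m + 1) - a m) * s ≤ x := by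
      nlinarith [mul_nonneg hs1 (sub_nonneg.2 hx), mul_nonneg hs0 (sub_nonneg.2 hx')]
    have hlow := hcomb (x := ρ t / 270) (by linarith) (by linarith)
    refine ⟨by linarith, hcomb' (by linarith) (by linarith), by linarith⟩
  have hσ0 {t : ℝ} (ht : t ≤ 0) : smoothInterpolation a n t = 1 := by
    rw [smoothInterpolation.eq_of_nonpos ht, ha1 (by omega)]
  have hσn {t : ℝ} (ht : n ≤ t) : smoothInterpolation a n t = 1 := by
    rw [smoothInterpolation.eq_of_le ht, ha1 (by omega)]
  refine ⟨smoothInterpolation a n, smoothInterpolation.contDiff, fun t => ?_, fun t ht => ?_,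
    fun t => ?_, fun t ht => ?_⟩
  · rcases le_total t 0 with h0 | h0
    · rw [hσ0 h0]; exact one_pos
    rcases lt_or_ge t n with h1 | h1
    · exact (hcell h0 h1).2.2
    · rw [hσn h1]; exact one_pos
  · have ht1 := hone t ht
    have hbounds : ρ t ≤ 270 * smoothInterpolation a n t ∧
        smoothInterpolation a n t ≤ 10 * ρ t ∧ 0 < smoothInterpolation a n t := by
      rcases lt_or_ge t n with h1 | h1
      · exact hcell ht.1 h1
      · have := hright (t := t) (by linarith)
        rw [hσn h1]
        refine ⟨?_, ?_, one_pos⟩ <;> linarith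
    obtain ⟨h1, h2, h3⟩ := hbounds
    constructor
    · rw [inv_mul_le_iff₀ (by positivity)]
      nlinarith [mul_nonneg hM0 h3.le]
    · nlinarith [mul_nonneg hM0 (zero_le_one.trans ht1)]
  · have := smoothInterpolation.abs_deriv_deriv_le (t := t) (by norm_num) hdiff hM
    linarith
  · rcases ht with ht | ht
    · rw [smoothInterpolation.eq_of_mem_Icc (m := 0) (by omega) (by simpa using ht),
        ha1 (by omega), ha1 (by omega), sub_self, zero_mul, add_zero]
    · exact hσn (hnR.trans ht.1)
end
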